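/- Let T be a tabloid and S a standard skew tableau of the same (shifted or unshifted) skew shape with n cells, and let k be the entry of S in the cell that contains 1 in T. Then FJ(T,S) = SWITCH ∘ J¹ ∘ … ∘ J^{k-1} ∘ J^{k+1} ∘ … ∘ Jⁿ ∘ J_1 applied to (T,S); that is, one may first perform the elementary backward step J_1, and then perform all elementary forward steps except the k-th, and the result (after switching components) equals FJ(T,S). -/

import Mathlib

open scoped Classical

/-- A (possibly shifted) skew Ferrers shape `μ/λ`, given by two partitions
`μ ⊇ λ` (with distinct parts in the shifted case). -/
structure SkewShape where
  shifted : Bool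
  mu : ℕ → ℕ
  lam : ℕ → ℕ
  mu_anti : ∀ i, mu (i + 1) ≤ mu i
  lam_anti : ∀ i, lam (i + 1) ≤ lam i
  lam_le_mu : ∀ i, lam i ≤ mu i
  mu_fin : ∃ r, ∀ i, r ≤ i → mu i = 0
  mu_strict : shifted = true → ∀ i, mu (i + 1) ≠ 0 → mu (i + 1) < mu i
  lam_strict : shifted = true → ∀ i, lam (i + 1) ≠ 0 → lam (i + 1) < lam i

/-- The set of cells of the (shifted) skew Ferrers diagram (rows and columns
are 0-indexed; in the shifted case row `i` is indented by `i` cells). -/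
def SkewShape.cells (sh : SkewShape) : Set (ℕ × ℕ) :=
  {c | if sh.shifted = true then
         c.1 + sh.lam c.1 ≤ c.2 ∧ c.2 < c.1 + sh.mu c.1
       else sh.lam c.1 ≤ c.2 ∧ c.2 < sh.mu c.1}

/-- A tabloid of shape `D`: a bijective filling of the cells of `D` with the
integers `1,…,n` where `n = |D|` (normalized to be `0` outside `D`). -/
def IsTabloid (D : Set (ℕ × ℕ)) (f : ℕ × ℕ → ℕ) : Prop :=
  Set.BijOn f D (Set.Icc 1 D.ncard) ∧ ∀ c, c ∉ D → f c = 0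

/-- A standard (skew) tableau: a tabloid with increasing rows and columns. -/
def IsStandard (D : Set (ℕ × ℕ)) (f : ℕ × ℕ → ℕ) : Prop :=
  IsTabloid D f ∧ ∀ c ∈ D,
    ((c.1, c.2 + 1) ∈ D → f c < f (c.1, c.2 + 1)) ∧
    ((c.1 + 1, c.2) ∈ D → f c < f (c.1 + 1, c.2))

/-- Exchange the entries of two cells. -/
def swapCells (f : ℕ × ℕ → ℕ) (a b : ℕ × ℕ) : ℕ × ℕ → ℕ :=
  Function.update (Function.update f a (f b)) b (f a)

/-- The value of a cell, `⊤` ("infinity") outside the shape `D`. -/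
noncomputable def jval (D : Set (ℕ × ℕ)) (f : ℕ × ℕ → ℕ) (c : ℕ × ℕ) : WithTop ℕ :=
  if c ∈ D then (f c : WithTop ℕ) else ⊤

/-- One step of forward jeu de taquin: the cell whose entry the moving entry at
`c` is exchanged with (the smaller of the right and lower neighbours, cells
outside the shape counting as `∞`), provided the moving entry is not yet
stable; `none` if it is stable. -/
noncomputable def fjTarget (D : Set (ℕ × ℕ)) (f : ℕ × ℕ → ℕ) (c : ℕ × ℕ) :
    Option (ℕ × ℕ) :=
  let r := (c.1, c.2 + 1)
  let d := (c.1 + 1, c.2)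
  if min (jval D f r) (jval D f d) < jval D f c then
    some (if jval D f r ≤ jval D f d then r else d)
  else none

/-- Iterated forward jeu de taquin on a pair of fillings, starting at cell `c`:
the moves are driven by the first filling and the exchanges are performed
simultaneously in both fillings. -/
noncomputable def fjIter (D : Set (ℕ × ℕ)) :
    ℕ → ((ℕ × ℕ → ℕ) × (ℕ × ℕ → ℕ)) → ℕ × ℕ →
      ((ℕ × ℕ → ℕ) × (ℕ × ℕ → ℕ)) × (ℕ × ℕ)
  | 0, p, c => (p, c)
  | fuel + 1, p, c =>
    match fjTarget D p.1 c with
    | none => (p, c)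
    | some c' => fjIter D fuel (swapCells p.1 c c', swapCells p.2 c c') c'

/-- Forward jeu de taquin in a single filling, starting at cell `c`. -/
noncomputable def fjRun (D : Set (ℕ × ℕ)) (f : ℕ × ℕ → ℕ) (c : ℕ × ℕ) :
    ℕ × ℕ → ℕ :=
  ((fjIter D D.ncard (f, f) c).1).1

/-- The cell of the shape `D` carrying the entry `v` of the filling `f`. -/
noncomputable def cellOf (D : Set (ℕ × ℕ)) (f : ℕ × ℕ → ℕ) (v : ℕ) : ℕ × ℕ :=
  Classical.epsilon fun c => c ∈ D ∧ f c = v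

/-- `MJaux D S n k T`: perform forward jeu de taquin with the entries of `T`
lying in the cells labelled `n, n-1, …, n-k+1` in `S`, in this order. -/
noncomputable def MJaux (D : Set (ℕ × ℕ)) (S : ℕ × ℕ → ℕ) (n : ℕ) :
    ℕ → (ℕ × ℕ → ℕ) → ℕ × ℕ → ℕ
  | 0, T => T
  | k + 1, T => fjRun D (MJaux D S n k T) (cellOf D S (n - k))

/-- Modified jeu de taquin `MJ_S(T)`: perform forward jeu de taquin with the
entries of `T` in decreasing order of the labels `S` assigns to their cells. -/
noncomputable def MJ (D : Set (ℕ × ℕ)) (S T : ℕ × ℕ → ℕ) : ℕ × ℕ → ℕ :=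
  MJaux D S D.ncard D.ncard T

/-- `FJaux D S₀ n k (T,S)`: perform forward jeu de taquin with the entries of the
first component in the cells labelled `n, n-1, …, n-k+1` in the fixed standard
tableau `S₀` (in this order), all transpositions being performed simultaneously
in the second component. -/
noncomputable def FJaux (D : Set (ℕ × ℕ)) (S0 : ℕ × ℕ → ℕ) (n : ℕ) :
    ℕ → ((ℕ × ℕ → ℕ) × (ℕ × ℕ → ℕ)) → (ℕ × ℕ → ℕ) × (ℕ × ℕ → ℕ)
  | 0, p => p
  | k + 1, p => (fjIter D D.ncard (FJaux D S0 n k p) (cellOf D S0 (n - k))).1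

/-- `FJ(T,S) = (S',T')`, where `T' = MJ_S(T)` and `S'` is obtained from `S` by
simultaneously performing all transpositions applied to `T` during modified
jeu de taquin with respect to `S`. -/
noncomputable def FJ (D : Set (ℕ × ℕ)) (T S : ℕ × ℕ → ℕ) :
    (ℕ × ℕ → ℕ) × (ℕ × ℕ → ℕ) :=
  Prod.swap (FJaux D S D.ncard D.ncard (T, S))

/-- One step of backward jeu de taquin inside the subshape `E`: the cell whose
entry the moving entry at `c` is exchanged with (the larger of the left and
upper neighbours inside `E`, missing neighbours counting as `0`), provided such
a neighbour exists; `none` otherwise. -/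
noncomputable def bjTarget (E : Set (ℕ × ℕ)) (f : ℕ × ℕ → ℕ) (c : ℕ × ℕ) :
    Option (ℕ × ℕ) :=
  let l := (c.1, c.2 - 1)
  let u := (c.1 - 1, c.2)
  let vl : ℕ := if 0 < c.2 ∧ l ∈ E then f l else 0
  let vu : ℕ := if 0 < c.1 ∧ u ∈ E then f u else 0
  if (0 < c.2 ∧ l ∈ E) ∨ (0 < c.1 ∧ u ∈ E) then
    some (if vu ≤ vl then l else u)
  else none

/-- Iterated backward jeu de taquin inside the subshape `E` on a pair of
fillings, starting at cell `c`: the moves are driven by the first filling and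
the exchanges are performed simultaneously in both fillings. -/
noncomputable def bjIter (E : Set (ℕ × ℕ)) :
    ℕ → ((ℕ × ℕ → ℕ) × (ℕ × ℕ → ℕ)) → ℕ × ℕ →
      ((ℕ × ℕ → ℕ) × (ℕ × ℕ → ℕ)) × (ℕ × ℕ)
  | 0, p, c => (p, c)
  | fuel + 1, p, c =>
    match bjTarget E p.1 c with
    | none => (p, c)
    | some c' => bjIter E fuel (swapCells p.1 c c', swapCells p.2 c c') c'

/-- The elementary forward step `Jⁱ` on a pair `(T,S)`: forward jeu de taquin in
`T` with the entry lying in the cell labelled `i` in `S`, the transpositions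
being performed simultaneously in `S`. -/
noncomputable def Jfwd (D : Set (ℕ × ℕ)) (i : ℕ)
    (p : (ℕ × ℕ → ℕ) × (ℕ × ℕ → ℕ)) : (ℕ × ℕ → ℕ) × (ℕ × ℕ → ℕ) :=
  (fjIter D D.ncard p (cellOf D p.2 i)).1

/-- The elementary backward step `J_i` on a pair `(S',T')`: backward jeu de
taquin in `T'`, restricted to the subshape of cells whose entries in `S'` are
`≥ i`, with the entry of `T'` lying in the cell labelled `i` in `S'`, the
transpositions being performed simultaneously in `S'`. -/
noncomputable def Jbwd (D : Set (ℕ × ℕ)) (i : ℕ)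
    (p : (ℕ × ℕ → ℕ) × (ℕ × ℕ → ℕ)) : (ℕ × ℕ → ℕ) × (ℕ × ℕ → ℕ) :=
  let q := (bjIter {c | c ∈ D ∧ i ≤ p.1 c} D.ncard (p.2, p.1) (cellOf D p.1 i)).1
  (q.2, q.1)

/-- `BJaux D k (S',T')`: for `i = 1` to `k`, perform backward jeu de taquin in
the second component, restricted to the subshape of cells whose entries in the
current first component are `≥ i`, with the entry lying in the cell labelled
`i` in the current first component, all transpositions being performed
simultaneously in the first component. -/
noncomputable def BJaux (D : Set (ℕ × ℕ)) :
    ℕ → ((ℕ × ℕ → ℕ) × (ℕ × ℕ → ℕ)) → (ℕ × ℕ → ℕ) × (ℕ × ℕ → ℕ)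
  | 0, p => p
  | i + 1, p =>
    let p' := BJaux D i p
    let q := (bjIter {c | c ∈ D ∧ i + 1 ≤ p'.1 c} D.ncard (p'.2, p'.1)
      (cellOf D p'.1 (i + 1))).1
    (q.2, q.1)

/-- `BJ(S',T') = (T,S)`. -/
noncomputable def BJ (D : Set (ℕ × ℕ)) (S' T' : ℕ × ℕ → ℕ) :
    (ℕ × ℕ → ℕ) × (ℕ × ℕ → ℕ) :=
  Prod.swap (BJaux D D.ncard (S', T'))

/-- `JfwdList D [i₁,…,iₘ] p = Jⁱ¹(Jⁱ²(… (Jⁱᵐ p) …))`. -/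
noncomputable def JfwdList (D : Set (ℕ × ℕ)) :
    List ℕ → ((ℕ × ℕ → ℕ) × (ℕ × ℕ → ℕ)) → (ℕ × ℕ → ℕ) × (ℕ × ℕ → ℕ)
  | [], p => p
  | i :: rest, p => Jfwd D i (JfwdList D rest p)

/-- `JbwdList D [i₁,…,iₘ] p = J_{i₁}(J_{i₂}(… (J_{iₘ} p) …))`. -/
noncomputable def JbwdList (D : Set (ℕ × ℕ)) :
    List ℕ → ((ℕ × ℕ → ℕ) × (ℕ × ℕ → ℕ)) → (ℕ × ℕ → ℕ) × (ℕ × ℕ → ℕ)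
  | [], p => p
  | i :: rest, p => Jbwd D i (JbwdList D rest p)

/-- `π` represents a permutation of `{1,…,n}` (it is the identity elsewhere). -/
def PermOn (n : ℕ) (π : Equiv.Perm ℕ) : Prop :=
  ∀ i, i ∉ Set.Icc 1 n → π i = i

/-- `S_π`: the tabloid obtained from `S` by replacing every entry `i` by `π i`. -/
noncomputable def permApply (D : Set (ℕ × ℕ)) (π : Equiv.Perm ℕ)
    (S : ℕ × ℕ → ℕ) : ℕ × ℕ → ℕ :=
  fun c => if c ∈ D then π (S c) else 0

/-- Forward jeu de taquin in a single filling together with the list of cells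
visited by the moving entry. -/
noncomputable def fjPath (D : Set (ℕ × ℕ)) :
    ℕ → (ℕ × ℕ → ℕ) → ℕ × ℕ → (ℕ × ℕ → ℕ) × List (ℕ × ℕ)
  | 0, f, c => (f, [c])
  | fuel + 1, f, c =>
    match fjTarget D f c with
    | none => (f, [c])
    | some c' =>
      let q := fjPath D fuel (swapCells f c c') c'
      (q.1, c :: q.2)

/-- Backward jeu de taquin inside the subshape `E` in a single filling together
with the list of cells visited by the moving entry. -/
noncomputable def bjPath (E : Set (ℕ × ℕ)) :
    ℕ → (ℕ × ℕ → ℕ) → ℕ × ℕ → (ℕ × ℕ → ℕ) × List (ℕ × ℕ)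
  | 0, f, c => (f, [c])
  | fuel + 1, f, c =>
    match bjTarget E f c with
    | none => (f, [c])
    | some c' =>
      let q := bjPath E fuel (swapCells f c c') c'
      (q.1, c :: q.2)

/-- `b` is the right or lower neighbour of `a`. -/
def CAdj (a b : ℕ × ℕ) : Prop := b = (a.1, a.2 + 1) ∨ b = (a.1 + 1, a.2)

lemma swapCells_eq (f : ℕ × ℕ → ℕ) (a b : ℕ × ℕ) :
    swapCells f a b = f ∘ Equiv.swap a b := by
  funext x
  simp only [swapCells, Function.update_apply, Function.comp, Equiv.swap_apply_def]
  by_cases h1 : x = a <;> by_cases h2 : x = b <;> simp_all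

lemma cellOf_eq {D : Set (ℕ × ℕ)} {f : ℕ × ℕ → ℕ} {v : ℕ} {a : ℕ × ℕ}
    (hf : Set.InjOn f D) (ha : a ∈ D) (hv : f a = v) : cellOf D f v = a := by
  have h : cellOf D f v ∈ D ∧ f (cellOf D f v) = v :=
    Classical.epsilon_spec (p := fun c => c ∈ D ∧ f c = v) ⟨a, ha, hv⟩
  exact hf h.1 ha (h.2.trans hv.symm)

lemma fjTarget_spec {D : Set (ℕ × ℕ)} {f : ℕ × ℕ → ℕ} {a b : ℕ × ℕ}
    (h : fjTarget D f a = some b) : b ∈ D ∧ CAdj a b := by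
  unfold fjTarget at h
  simp only at h
  split_ifs at h with h1 h2
  · simp only [Option.some.injEq] at h
    subst h
    refine ⟨?_, Or.inl rfl⟩
    by_contra hb
    rw [min_eq_left h2] at h1
    simp [jval, hb] at h1
  · simp only [Option.some.injEq] at h
    subst h
    refine ⟨?_, Or.inr rfl⟩
    by_contra hb
    apply h2
    simp [jval, hb]

lemma fjTarget_congr {D : Set (ℕ × ℕ)} {f g : ℕ × ℕ → ℕ} {a : ℕ × ℕ}
    (h0 : f a = g a) (h : ∀ b ∈ D, CAdj a b → f b = g b) :
    fjTarget D f a = fjTarget D g a := by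
  have e0 : jval D f a = jval D g a := by simp only [jval, h0]
  have e : ∀ b, CAdj a b → jval D f b = jval D g b := by
    intro b hb
    unfold jval
    split_ifs with hD
    · rw [h b hD hb]
    · rfl
  unfold fjTarget
  simp only [e0, e _ (Or.inl rfl), e _ (Or.inr rfl)]

/-- locality of a forward slide -/
lemma fjIter_local (D G : Set (ℕ × ℕ)) (hG : ∀ a ∈ G, ∀ b ∈ D, CAdj a b → b ∈ G) (m : ℕ) :
    ∀ (f : ℕ × ℕ → ℕ) (a : ℕ × ℕ), a ∈ G →
      ∃ τ : Equiv.Perm (ℕ × ℕ), (∀ x, x ∉ G → τ x = x) ∧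
        ∀ g h : ℕ × ℕ → ℕ, (∀ x ∈ G, g x = f x) →
          (fjIter D m (g, h) a).1 = (g ∘ τ, h ∘ τ) := by
  induction m with
  | zero => 
    intro f a ha
    exact ⟨1, fun _ _ => rfl, fun g h _ => rfl⟩
  | succ m ih =>
    intro f a ha
    have key : ∀ g : ℕ × ℕ → ℕ, (∀ x ∈ G, g x = f x) → fjTarget D g a = fjTarget D f a :=
      fun g hg => fjTarget_congr (hg a ha) (fun b hb hab => hg b (hG a ha b hb hab))
    rcases hb : fjTarget D f a with _ | b
    · refine ⟨1, fun _ _ => rfl, fun g h hg => ?_⟩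
      simp only [fjIter, key g hg, hb]
      rfl
    · obtain ⟨hbD, hab⟩ := fjTarget_spec hb
      have hbG := hG a ha b hbD hab
      obtain ⟨τ, hτ, H⟩ := ih (f ∘ Equiv.swap a b) b hbG
      refine ⟨τ.trans (Equiv.swap a b), ?_, ?_⟩
      · intro x hx
        rw [Equiv.trans_apply, hτ x hx, Equiv.swap_apply_of_ne_of_ne]
        · rintro rfl; exact hx ha
        · rintro rfl; exact hx hbG
      · intro g h hg
        simp only [fjIter, key g hg, hb, swapCells_eq]
        rw [H]
        · rfl
        · intro x hx
          simp only [Function.comp]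
          apply hg
          rw [Equiv.swap_apply_def]
          split_ifs <;> assumption

/-- enough fuel -/
lemma fjIter_fuel (D : Set (ℕ × ℕ)) (hfin : D.Finite) (m : ℕ) :
    ∀ (p : (ℕ × ℕ → ℕ) × (ℕ × ℕ → ℕ)) (a : ℕ × ℕ),
      {x | x ∈ D ∧ a.1 + a.2 < x.1 + x.2}.ncard ≤ m →
      fjIter D (m + 1) p a = fjIter D m p a := by
  induction m with
  | zero =>
    intro p a h
    have hf : {x | x ∈ D ∧ a.1 + a.2 < x.1 + x.2}.Finite := hfin.subset fun x hx => hx.1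
    have h0 : {x | x ∈ D ∧ a.1 + a.2 < x.1 + x.2} = ∅ := by
      rw [← Set.ncard_eq_zero hf]; omega
    rcases hb : fjTarget D p.1 a with _ | b
    · simp only [fjIter, hb]
    · obtain ⟨hbD, hab⟩ := fjTarget_spec hb
      have : b ∈ {x | x ∈ D ∧ a.1 + a.2 < x.1 + x.2} := by
        refine ⟨hbD, ?_⟩
        rcases hab with rfl | rfl <;> simp <;> omega
      rw [h0] at this
      exact this.elim
  | succ m ih =>
    intro p a h
    rcases hb : fjTarget D p.1 a with _ | b
    · simp only [fjIter, hb]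
    · obtain ⟨hbD, hab⟩ := fjTarget_spec hb
      have hlt : a.1 + a.2 < b.1 + b.2 := by
        rcases hab with rfl | rfl <;> simp <;> omega
      have hf : {x | x ∈ D ∧ a.1 + a.2 < x.1 + x.2}.Finite := hfin.subset fun x hx => hx.1
      have hss : {x | x ∈ D ∧ b.1 + b.2 < x.1 + x.2} ⊂ {x | x ∈ D ∧ a.1 + a.2 < x.1 + x.2} := by
        rw [Set.ssubset_iff_of_subset]
        · exact ⟨b, ⟨hbD, hlt⟩, fun hh => lt_irrefl _ hh.2⟩
        · exact fun x hx => ⟨hx.1, hlt.trans hx.2⟩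
      have := Set.ncard_lt_ncard hss hf
      rw [fjIter, fjIter]
      simp only [hb]
      exact ih _ _ (by omega)

lemma perm_mem {D G : Set (ℕ × ℕ)} (hGD : G ⊆ D) {σ : Equiv.Perm (ℕ × ℕ)}
    (hσ : ∀ x, x ∉ G → σ x = x) {x : ℕ × ℕ} (hx : x ∈ D) : σ x ∈ D := by
  by_contra h
  have h1 := hσ (σ x) (fun h' => h (hGD h'))
  have h2 := σ.injective h1
  rw [h2] at h
  exact h hx

lemma injOn_perm {D : Set (ℕ × ℕ)} {f : ℕ × ℕ → ℕ} (hf : Set.InjOn f D)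
    {σ : Equiv.Perm (ℕ × ℕ)} (hσ : ∀ x ∈ D, σ x ∈ D) : Set.InjOn (f ∘ σ) D := by
  intro x hx y hy h
  exact σ.injective (hf (hσ x hx) (hσ y hy) h)

/-- `FJ` may skip the entry `1`. -/
lemma fj_skip (D : Set (ℕ × ℕ)) (T S : ℕ × ℕ → ℕ)
    (hS : Set.BijOn S D (Set.Icc 1 D.ncard))
    (hmono : ∀ a b, a ∈ D → b ∈ D → CAdj a b → S a < S b)
    (c : ℕ × ℕ) (hc : c ∈ D) (hc1 : T c = 1) (hTpos : ∀ x ∈ D, 1 ≤ T x) :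
    ∀ j, j ≤ D.ncard →
      FJaux D S D.ncard j (T, S) =
        JfwdList D ((List.range' (D.ncard - j + 1) j).filter (fun i => i ≠ S c)) (T, S) ∧
      ∃ σ : Equiv.Perm (ℕ × ℕ), (∀ x, x ∉ {x | x ∈ D ∧ D.ncard - j < S x} → σ x = x) ∧
        FJaux D S D.ncard j (T, S) = (T ∘ σ, S ∘ σ) := by
  intro j
  induction j with
  | zero => 
    intro _
    exact ⟨rfl, 1, fun _ _ => rfl, rfl⟩
  | succ j ih =>
    intro hj
    obtain ⟨h1, σ, hσ, h2⟩ := ih (by omega)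
    set n := D.ncard with hn
    obtain ⟨i, hi⟩ : ∃ i, i = n - j := ⟨_, rfl⟩
    have hi2 : n - (j + 1) + 1 = i := by omega
    have hGD : {x | x ∈ D ∧ n - j < S x} ⊆ D := fun x hx => hx.1
    obtain ⟨a, haD, haS⟩ := hS.surjOn (show i ∈ Set.Icc 1 n from ⟨by omega, by omega⟩)
    have hσa : σ a = a := hσ a (fun h => by have := h.2; omega)
    have hσD : ∀ x ∈ D, σ x ∈ D := fun x hx => perm_mem hGD hσ hx
    have hcell : cellOf D S i = a := cellOf_eq hS.injOn haD haS
    have hcell2 : cellOf D (S ∘ σ) i = a :=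
      cellOf_eq (injOn_perm hS.injOn hσD) haD (by simp [hσa, haS])
    obtain ⟨τ, hτ, H⟩ := fjIter_local D {x | x ∈ D ∧ n - (j + 1) < S x}
      (fun x hx b hb hab => ⟨hb, lt_trans hx.2 (hmono x b hx.1 hb hab)⟩) n (T ∘ σ) a
      ⟨haD, by omega⟩
    have hstep : FJaux D S n (j + 1) (T, S) = (fjIter D n (T ∘ σ, S ∘ σ) a).1 := by
      rw [FJaux, h2, ← hi, hcell]
    have hrange : List.range' (n - (j + 1) + 1) (j + 1) = i :: List.range' (n - j + 1) j := by
      rw [hi2, List.range'_succ, hi]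
    refine ⟨?_, τ.trans σ, ?_, ?_⟩
    · rw [hrange, hstep]
      by_cases hik : i = S c
      · have hac : a = c := hS.injOn haD hc (by rw [haS, hik])
        rw [List.filter_cons_of_neg (by simpa using hik), ← h1, h2]
        have ht : fjTarget D (T ∘ σ) a = none := by
          unfold fjTarget
          have hv : jval D (T ∘ σ) a = ((1 : ℕ) : WithTop ℕ) := by
            simp [jval, haD, hσa, hac ▸ hc1]
          have hge : ∀ x, ((1 : ℕ) : WithTop ℕ) ≤ jval D (T ∘ σ) x := by
            intro x
            unfold jval
            split_ifs with hx
            · exact WithTop.coe_le_coe.2 (hTpos _ (hσD x hx))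
            · exact le_top
          rw [hv]
          simp only
          rw [if_neg (not_lt.2 (le_min (hge _) (hge _)))]
        cases hm : n with
        | zero => rfl
        | succ m => simp only [fjIter, ht]
      · rw [List.filter_cons_of_pos (by simpa using hik), JfwdList, ← h1, h2, Jfwd]
        simp only [hcell2]
        rfl
    · intro x hx
      rw [Equiv.trans_apply, hτ x hx]
      exact hσ x (fun h => hx ⟨h.1, by have := h.2; omega⟩)
    · rw [hstep, H _ _ (fun _ _ => rfl)]
      rfl

/-- `S` is standard outside of the cell `c` which contains the `1` of `T`. -/
structure Good (D : Set (ℕ × ℕ)) (T S : ℕ × ℕ → ℕ) (c : ℕ × ℕ) : Prop where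
  bij : Set.BijOn S D (Set.Icc 1 D.ncard)
  mem : c ∈ D
  one : T c = 1
  gt : ∀ x ∈ D, x ≠ c → 1 < T x
  mono : ∀ a b, a ∈ D → b ∈ D → a ≠ c → b ≠ c → CAdj a b → S a < S b
  mono2 : ∀ a b, a ∈ D → b ∈ D → CAdj a c → CAdj c b → S a < S b

lemma bjTarget_spec {D : Set (ℕ × ℕ)} {S : ℕ × ℕ → ℕ} {c d : ℕ × ℕ}
    (hpos : ∀ x ∈ D, 1 ≤ S x) (h : bjTarget D S c = some d) :
    d ∈ D ∧ CAdj d c ∧ ∀ a ∈ D, CAdj a c → S a ≤ S d := by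
  obtain ⟨x, y⟩ := c
  unfold bjTarget at h
  simp only at h
  have hA : ∀ a ∈ D, CAdj a (x, y) →
      (0 < y ∧ a = (x, y - 1)) ∨ (0 < x ∧ a = (x - 1, y)) := by
    rintro ⟨a1, a2⟩ ha hab
    simp only [CAdj, Prod.mk.injEq] at hab ⊢
    omega
  have hl : 0 < y → CAdj (x, y - 1) (x, y) := by
    intro h; left; simp; omega
  have hu : 0 < x → CAdj (x - 1, y) (x, y) := by
    intro h; right; simp; omega
  by_cases h1 : 0 < y ∧ (x, y - 1) ∈ D <;> by_cases h2 : 0 < x ∧ (x - 1, y) ∈ D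
  · simp only [h1, h2, and_self, if_true, or_self, Option.some.injEq] at h
    split_ifs at h with h3
    · subst h
      refine ⟨h1.2, hl h1.1, fun a ha hab => ?_⟩
      rcases hA a ha hab with ⟨_, rfl⟩ | ⟨_, rfl⟩
      · exact le_rfl
      · exact h3
    · subst h
      refine ⟨h2.2, hu h2.1, fun a ha hab => ?_⟩
      rcases hA a ha hab with ⟨_, rfl⟩ | ⟨_, rfl⟩
      · omega
      · exact le_rfl
  · rw [if_pos (Or.inl h1), if_neg h2, if_pos (Nat.zero_le _)] at h
    simp only [Option.some.injEq] at h
    subst h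
    refine ⟨h1.2, hl h1.1, fun a ha hab => ?_⟩
    rcases hA a ha hab with ⟨_, rfl⟩ | ⟨h3, rfl⟩
    · exact le_rfl
    · exact absurd ⟨h3, ha⟩ h2
  · have := hpos _ h2.2
    rw [if_pos (Or.inr h2), if_neg h1, if_pos h2, if_neg (by omega)] at h
    simp only [Option.some.injEq] at h
    subst h
    refine ⟨h2.2, hu h2.1, fun a ha hab => ?_⟩
    rcases hA a ha hab with ⟨h3, rfl⟩ | ⟨_, rfl⟩
    · exact absurd ⟨h3, ha⟩ h1
    · exact le_rfl
  · rw [if_neg (by tauto)] at h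
    exact absurd h (by simp)

lemma CAdj.rank {a b : ℕ × ℕ} (h : CAdj a b) : b.1 + b.2 = a.1 + a.2 + 1 := by
  rcases h with rfl | rfl <;> simp <;> omega

lemma CAdj.ne {a b : ℕ × ℕ} (h : CAdj a b) : a ≠ b := by
  intro hab
  have := h.rank
  rw [hab] at this
  omega

lemma good_step {D : Set (ℕ × ℕ)} {T S : ℕ × ℕ → ℕ} {c d : ℕ × ℕ} (hg : Good D T S c)
    (hd : d ∈ D) (hdc : CAdj d c) (hmax : ∀ a ∈ D, CAdj a c → S a ≤ S d) :
    Good D (T ∘ Equiv.swap c d) (S ∘ Equiv.swap c d) d := by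
  have hne : d ≠ c := hdc.ne
  have hsD : ∀ x ∈ D, Equiv.swap c d x ∈ D := by
    intro x hx
    rw [Equiv.swap_apply_def]
    split_ifs
    exacts [hd, hg.mem, hx]
  refine ⟨?_, hd, ?_, ?_, ?_, ?_⟩
  · refine hg.bij.comp ⟨hsD, (Equiv.swap c d).injective.injOn, ?_⟩
    intro x hx
    exact ⟨Equiv.swap c d x, hsD x hx, Equiv.swap_apply_self c d x⟩
  · simp [hg.one]
  · intro x hx hxd
    apply hg.gt _ (hsD x hx)
    intro h
    apply hxd
    have := congrArg (Equiv.swap c d) h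
    simpa using this
  · intro a b ha hb had hbd hab
    simp only [Function.comp]
    by_cases hac : a = c
    · subst hac
      have hba : b ≠ a := fun h => hab.ne h.symm
      rw [Equiv.swap_apply_left, Equiv.swap_apply_of_ne_of_ne hba hbd]
      exact hg.mono2 d b hd hb hdc hab
    · rw [Equiv.swap_apply_of_ne_of_ne hac had]
      by_cases hbc : b = c
      · subst hbc
        rw [Equiv.swap_apply_left]
        refine lt_of_le_of_ne (hmax a ha hab) fun h => had (hg.bij.injOn ha hd h)
      · rw [Equiv.swap_apply_of_ne_of_ne hbc hbd]
        exact hg.mono a b ha hb hac hbc hab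
  · intro a b ha hb had hdb
    simp only [Function.comp]
    have hac : a ≠ c := by
      rintro rfl
      have h1 := had.rank
      have h2 := hdc.rank
      omega
    rw [Equiv.swap_apply_of_ne_of_ne hac had.ne]
    have h1 : S a < S d := hg.mono a d ha hd hac hne had
    by_cases hbc : b = c
    · subst hbc
      rwa [Equiv.swap_apply_left]
    · rw [Equiv.swap_apply_of_ne_of_ne hbc (fun h => hdb.ne h.symm)]
      exact h1.trans (hg.mono d b hd hb hne hbc hdb)

/-- A single backward step does not change the result. -/
lemma bj_one {D : Set (ℕ × ℕ)} (hfin : D.Finite) {T S : ℕ × ℕ → ℕ} {c d : ℕ × ℕ}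
    (hg : Good D T S c)
    (hd : d ∈ D) (hdc : CAdj d c) (hmax : ∀ a ∈ D, CAdj a c → S a ≤ S d) :
    ∀ j, j ≤ D.ncard →
      (S d ≤ D.ncard - j →
        ∃ σ : Equiv.Perm (ℕ × ℕ),
          (∀ x, x ∉ {x | x ∈ D ∧ x ≠ c ∧ D.ncard - j < S x} → σ x = x) ∧
          JfwdList D ((List.range' (D.ncard - j + 1) j).filter (fun i => i ≠ S c)) (T, S)
            = (T ∘ σ, S ∘ σ) ∧
          JfwdList D ((List.range' (D.ncard - j + 1) j).filter (fun i => i ≠ S c))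
            (T ∘ Equiv.swap c d, S ∘ Equiv.swap c d)
            = ((T ∘ σ) ∘ Equiv.swap c d, (S ∘ σ) ∘ Equiv.swap c d)) ∧
      (D.ncard - j < S d →
          JfwdList D ((List.range' (D.ncard - j + 1) j).filter (fun i => i ≠ S c)) (T, S)
            = JfwdList D ((List.range' (D.ncard - j + 1) j).filter (fun i => i ≠ S c))
            (T ∘ Equiv.swap c d, S ∘ Equiv.swap c d)) := by
  have hne : d ≠ c := hdc.ne
  intro j
  induction j with
  | zero =>
    intro _
    refine ⟨fun _ => ⟨1, fun _ _ => rfl, rfl, rfl⟩, fun h => ?_⟩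
    have := (hg.bij.mapsTo hd).2
    omega
  | succ j ih =>
    intro hj
    obtain ⟨ih1, ih2⟩ := ih (by omega)
    set n := D.ncard with hn
    obtain ⟨i, hi⟩ : ∃ i, i = n - j := ⟨_, rfl⟩
    have hi2 : n - (j + 1) + 1 = i := by omega
    have hrange : List.range' (n - (j + 1) + 1) (j + 1) = i :: List.range' (n - j + 1) j := by
      rw [hi2, List.range'_succ, hi]
    rw [hrange]
    by_cases hlt : n - j < S d
    · refine ⟨fun h => by omega, fun _ => ?_⟩
      by_cases hik : i = S c
      · rw [List.filter_cons_of_neg (by simpa using hik)]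
        exact ih2 hlt
      · rw [List.filter_cons_of_pos (by simpa using hik), JfwdList, JfwdList, ih2 hlt]
    · obtain ⟨σ, hσ, hA, hB⟩ := ih1 (by omega)
      have hGD : {x | x ∈ D ∧ x ≠ c ∧ n - j < S x} ⊆ D := fun x hx => hx.1
      have hσc : σ c = c := hσ c (fun h => h.2.1 rfl)
      have hσd : σ d = d := hσ d (fun h => by have := h.2.2; omega)
      have hσD : ∀ x ∈ D, σ x ∈ D := fun x hx => perm_mem hGD hσ hx
      have hsD : ∀ x ∈ D, Equiv.swap c d x ∈ D := by
        intro x hx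
        rw [Equiv.swap_apply_def]
        split_ifs
        exacts [hd, hg.mem, hx]
      have hinj : Set.InjOn (S ∘ σ) D := injOn_perm hg.bij.injOn hσD
      have hinj2 : Set.InjOn ((S ∘ σ) ∘ Equiv.swap c d) D := injOn_perm hinj hsD
      by_cases hik : i = S c
      · rw [List.filter_cons_of_neg (by simpa using hik), hA, hB]
        have : i ≠ S d := fun h => hne (hg.bij.injOn hd hg.mem (by omega))
        refine ⟨fun h => ⟨σ, ?_, rfl, rfl⟩, fun h => by omega⟩
        intro x hx
        exact hσ x (fun h => hx ⟨h.1, h.2.1, by have := h.2.2; omega⟩)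
      · rw [List.filter_cons_of_pos (by simpa using hik), JfwdList, JfwdList, hA, hB]
        obtain ⟨a, haD, haS⟩ := hg.bij.surjOn (show i ∈ Set.Icc 1 n from ⟨by omega, by omega⟩)
        have hac : a ≠ c := by rintro rfl; exact hik haS.symm
        have hσa : σ a = a := hσ a (fun h => by have := h.2.2; omega)
        have hcellA : cellOf D (S ∘ σ) i = a := cellOf_eq hinj haD (by simp [hσa, haS])
        by_cases had : a = d
        · subst had
          refine ⟨fun h => by omega, fun _ => ?_⟩
          have hcellB : cellOf D ((S ∘ σ) ∘ Equiv.swap c a) i = c :=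
            cellOf_eq hinj2 hg.mem (by simp [hσa, haS])
          simp only [Jfwd, hcellA, hcellB]
          rw [← hn]
          obtain ⟨m, hm⟩ : ∃ m, n = m + 1 := ⟨n - 1, by omega⟩
          have ht : fjTarget D (T ∘ σ) a = some c := by
            have hvc : jval D (T ∘ σ) c = ((1 : ℕ) : WithTop ℕ) := by
              simp [jval, hg.mem, hσc, hg.one]
            have hgt : ∀ x, x ≠ c → ((1 : ℕ) : WithTop ℕ) < jval D (T ∘ σ) x := by
              intro x hxc
              unfold jval
              split_ifs with hx
              · refine WithTop.coe_lt_coe.2 (hg.gt _ (hσD x hx) fun h => hxc ?_)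
                exact σ.injective (h.trans hσc.symm)
              · exact WithTop.coe_lt_top _
            have ha := hgt a hac
            unfold fjTarget
            simp only
            rcases hdc with h | h
            · have hx := hgt (a.1 + 1, a.2) (by rw [h]; simp)
              rw [← h, hvc, if_pos (lt_of_le_of_lt (min_le_left _ _) ha), if_pos hx.le]
            · have hx := hgt (a.1, a.2 + 1) (by rw [h]; simp)
              rw [← h, hvc, if_pos (lt_of_le_of_lt (min_le_right _ _) ha),
                if_neg (not_le.2 hx)]
          have hfuel := fjIter_fuel D hfin m
            ((T ∘ σ) ∘ Equiv.swap c a, (S ∘ σ) ∘ Equiv.swap c a) c (by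
              have hss : {x | x ∈ D ∧ c.1 + c.2 < x.1 + x.2} ⊂ D := by
                rw [Set.ssubset_iff_of_subset (fun x hx => hx.1)]
                exact ⟨c, hg.mem, fun h => lt_irrefl _ h.2⟩
              have := Set.ncard_lt_ncard hss hfin
              omega)
          rw [hm, hfuel, fjIter]
          simp only [ht, swapCells_eq, Equiv.swap_comm a c]
        · have hiSd : i ≠ S d := fun h => had (hg.bij.injOn haD hd (by omega))
          refine ⟨fun _ => ?_, fun h => by omega⟩
          have hcellB : cellOf D ((S ∘ σ) ∘ Equiv.swap c d) i = a :=
            cellOf_eq hinj2 haD (by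
              simp [Equiv.swap_apply_of_ne_of_ne hac had, hσa, haS])
          obtain ⟨τ, hτ, H⟩ := fjIter_local D {x | x ∈ D ∧ x ≠ c ∧ n - (j + 1) < S x}
            (by
              intro x hx b hb hab
              have hx2 := hx.2.2
              have hxS : S x ≠ S d → S d < S x := by omega
              have hbc : b ≠ c := by
                rintro rfl
                have := hmax x hx.1 hab
                have hxd : x = d := hg.bij.injOn hx.1 hd (by omega)
                rw [hxd] at hx2
                omega
              exact ⟨hb, hbc, lt_trans hx2 (hg.mono x b hx.1 hb hx.2.1 hbc hab)⟩)
            n (T ∘ σ) a ⟨haD, hac, by omega⟩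
          have hτc : τ c = c := hτ c (fun h => h.2.1 rfl)
          have hτd : τ d = d := hτ d (fun h => by have := h.2.2; omega)
          have hcomm : ∀ x, Equiv.swap c d (τ x) = τ (Equiv.swap c d x) := by
            intro x
            by_cases h1 : x = c
            · subst h1; simp [hτc, hτd]
            by_cases h2 : x = d
            · subst h2; simp [hτc, hτd]
            rw [Equiv.swap_apply_of_ne_of_ne h1 h2, Equiv.swap_apply_of_ne_of_ne]
            · intro h; exact h1 (τ.injective (h.trans hτc.symm))
            · intro h; exact h2 (τ.injective (h.trans hτd.symm))
          refine ⟨τ.trans σ, ?_, ?_, ?_⟩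
          · intro x hx
            rw [Equiv.trans_apply, hτ x hx]
            exact hσ x (fun h => hx ⟨h.1, h.2.1, by have := h.2.2; omega⟩)
          · simp only [Jfwd, hcellA]
            rw [← hn, H _ _ (fun _ _ => rfl)]
            rfl
          · simp only [Jfwd, hcellB]
            rw [← hn, H]
            · refine Prod.ext ?_ ?_ <;> funext x <;> simp [hcomm]
            · intro x hx
              have hxd : x ≠ d := by
                rintro rfl
                have := hx.2.2
                omega
              simp [Equiv.swap_apply_of_ne_of_ne hx.2.1 hxd]

lemma bj_skip (D : Set (ℕ × ℕ)) (hfin : D.Finite) (m k : ℕ) :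
    ∀ (T S : ℕ × ℕ → ℕ) (c : ℕ × ℕ), Good D T S c → S c = k →
      JfwdList D ((List.range' (D.ncard - D.ncard + 1) D.ncard).filter (fun i => i ≠ k)) (T, S) =
      JfwdList D ((List.range' (D.ncard - D.ncard + 1) D.ncard).filter (fun i => i ≠ k))
        ((bjIter D m (S, T) c).1.2, (bjIter D m (S, T) c).1.1) := by
  induction m with
  | zero => intro T S c _ _; rfl
  | succ m ih =>
    intro T S c hg hk
    rcases hb : bjTarget D S c with _ | d
    · simp only [bjIter, hb]
    · have hpos : ∀ x ∈ D, 1 ≤ S x := fun x hx => (hg.bij.mapsTo hx).1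
      obtain ⟨hd, hdc, hmax⟩ := bjTarget_spec hpos hb
      have h1 := (bj_one hfin hg hd hdc hmax D.ncard le_rfl).2 (by
        have := hpos d hd
        omega)
      rw [hk] at h1
      rw [h1, ih _ _ d (good_step hg hd hdc hmax) (by simp [hk])]
      simp only [bjIter, hb, swapCells_eq]

/-- identity (1): for a tabloid `T` and a standard skew
tableau `S` of the same (shifted or unshifted) skew shape with `n` cells, if
`k` is the entry of `S` in the cell that contains `1` in `T`, then
`FJ(T,S) = SWITCH ∘ J¹ ∘ … ∘ J^{k-1} ∘ J^{k+1} ∘ … ∘ Jⁿ ∘ J_1 (T,S)`. -/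
theorem fj_eq_switch_chain_skip_j1 (sh : SkewShape) (T S : ℕ × ℕ → ℕ)
    (hT : IsTabloid sh.cells T) (hS : IsStandard sh.cells S)
    (c : ℕ × ℕ) (hc : c ∈ sh.cells) (hc1 : T c = 1) :
    FJ sh.cells T S =
      Prod.swap (JfwdList sh.cells
        ((List.range' 1 sh.cells.ncard).filter (fun i => i ≠ S c))
        (Jbwd sh.cells 1 (T, S))) := by
  set D := sh.cells with hD
  have hTpos : ∀ x ∈ D, 1 ≤ T x := fun x hx => (hT.1.mapsTo hx).1
  have hn : 1 ≤ D.ncard := by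
    have := hT.1.mapsTo hc
    exact this.1.trans this.2
  have hfin : D.Finite := Set.finite_of_ncard_pos hn
  have hE : {x | x ∈ D ∧ 1 ≤ T x} = D := by
    ext x
    exact ⟨fun h => h.1, fun h => ⟨h, hTpos x h⟩⟩
  have hcell : cellOf D T 1 = c := cellOf_eq hT.1.injOn hc hc1
  have h1 := (fj_skip D T S hS.1.1 (fun a b ha hb hab => by
      rcases hab with rfl | rfl
      · exact (hS.2 a ha).1 hb
      · exact (hS.2 a ha).2 hb) c hc hc1 hTpos D.ncard le_rfl).1
  have hg : Good D T S c := by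
    refine ⟨hS.1.1, hc, hc1, ?_, ?_, ?_⟩
    · intro x hx hxc
      refine lt_of_le_of_ne (hTpos x hx) ?_
      intro h
      exact hxc (hT.1.injOn hx hc (by rw [← h, hc1]))
    · intro a b ha hb _ _ hab
      rcases hab with rfl | rfl
      · exact (hS.2 a ha).1 hb
      · exact (hS.2 a ha).2 hb
    · intro a b ha hb hac hcb
      have e1 : S a < S c := by
        rcases hac with rfl | rfl
        · exact (hS.2 a ha).1 hc
        · exact (hS.2 a ha).2 hc
      have e2 : S c < S b := by
        rcases hcb with rfl | rfl
        · exact (hS.2 c hc).1 hb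
        · exact (hS.2 c hc).2 hb
      exact e1.trans e2
  have h2 := bj_skip D hfin D.ncard (S c) T S c hg rfl
  have hJ : Jbwd D 1 (T, S) =
      ((bjIter D D.ncard (S, T) c).1.2, (bjIter D D.ncard (S, T) c).1.1) := by
    simp only [Jbwd, hE, hcell]
  unfold FJ
  rw [h1, hJ, h2, Nat.sub_self, Nat.zero_add]
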